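/- arXiv:2110.15714 — 5 statements merged into one kernel-verified Lean document; each statement's English description precedes it below -/
import Mathlib

section
/- Let F = (W, R) be a rooted Kripke frame. Then the map f₀ is a p-morphism of n-frames from N_ω(F) onto N(F^♯). -/
open Classical

noncomputable section

/- ### Propositional modal formulas -/

/-- Propositional modal formulas: `⊥`, letters, `→`, `□`. -/
inductive MF : Type
  | falsum : MF
  | prop : ℕ → MF
  | impl : MF → MF → MF
  | box : MF → MF

def negMF (A : MF) : MF := .impl A .falsum
def diaMF (A : MF) : MF := negMF (.box (negMF A))

/-- `□^k A`. -/
def boxIter : ℕ → MF → MF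
  | 0, A => A
  | k+1, A => boxIter k (.box A)

/-- the one-way PTC axiom `□p → □^k p`. -/
def ptcAxiom (k : ℕ) : MF := .impl (.box (.prop 0)) (boxIter k (.prop 0))

/-- a formula is closed if it contains no propositional letters. -/
def ClosedMF : MF → Prop
  | .falsum => True
  | .prop _ => False
  | .impl A B => ClosedMF A ∧ ClosedMF B
  | .box A => ClosedMF A

/- ### Kripke semantics -/

def ksat {W : Type} (R : W → W → Prop) (V : ℕ → Set W) : W → MF → Prop
  | _, .falsum => False
  | x, .prop n => x ∈ V n
  | x, .impl A B => ksat R V x A → ksat R V x B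
  | x, .box A => ∀ y, R x y → ksat R V y A

/-- the logic of a Kripke frame: all formulas valid on it. -/
def KLog {W : Type} (R : W → W → Prop) : Set MF := {A | ∀ V x, ksat R V x A}

/-- p-morphism of Kripke frames. -/
def IsPMorphismK {W U : Type} (R : W → W → Prop) (S : U → U → Prop) (f : W → U) : Prop :=
  Function.Surjective f ∧
  (∀ w v, R w v → S (f w) (f v)) ∧
  (∀ w u', S (f w) u' → ∃ v, R w v ∧ f v = u')

/- ### Neighbourhood semantics -/

def nbsat {X : Type} (τ : X → Filter X) (V : ℕ → Set X) : X → MF → Prop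
  | _, .falsum => False
  | x, .prop n => x ∈ V n
  | x, .impl A B => nbsat τ V x A → nbsat τ V x B
  | x, .box A => ∃ U ∈ τ x, ∀ y ∈ U, nbsat τ V y A

def NLog {X : Type} (τ : X → Filter X) : Set MF := {A | ∀ V x, nbsat τ V x A}

/-- the neighbourhood frame `N(F)` of a Kripke frame: the filter of supersets of `R(w)`. -/
def nbhdOf {W : Type} (R : W → W → Prop) : W → Filter W :=
  fun w => Filter.principal {u | R w u}

/-- p-morphism of neighbourhood frames. -/
def IsPMorphismN {X Y : Type} (τ : X → Filter X) (σ : Y → Filter Y) (f : X → Y) : Prop :=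
  Function.Surjective f ∧
  (∀ x, ∀ U ∈ τ x, f '' U ∈ σ (f x)) ∧
  (∀ x, ∀ V ∈ σ (f x), f ⁻¹' V ∈ τ x)

/- ### Rootedness and unravelling -/

/-- every point is reachable from `w0`. -/
def IsRootedAt {W : Type} (R : W → W → Prop) (w0 : W) : Prop :=
  ∀ w, Relation.ReflTransGen R w0 w

/-- the set of rooted paths of `(W, R)` with root `w0`. -/
def Unravel (W : Type) (R : W → W → Prop) (w0 : W) : Type :=
  {l : List W // l.head? = some w0 ∧ l.Chain' R}

/-- `π` : the last point of a rooted path. -/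
def Unravel.last {W : Type} {R : W → W → Prop} {w0 : W} (p : Unravel W R w0) : W :=
  p.1.getLast (fun h => by have h1 := p.2.1; rw [h] at h1; simp at h1)

/-- the relation `R^♯` of the unravelling: one-step extension of paths. -/
def RSharp {W : Type} (R : W → W → Prop) (w0 : W) (p q : Unravel W R w0) : Prop :=
  ∃ v, q.1 = p.1 ++ [v] ∧ R p.last v

/- ### Pseudo-infinite paths with stops -/

/-- `st(α)`: the length of the prefix before the infinite tail of zeros. -/
def stOf {A : Type} (α : ℕ → Option A) : ℕ :=
  sInf {m | ∀ k, m ≤ k → α k = none}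

/-- the zero-free part of an eventually-zero sequence. -/
def zf {A : Type} (α : ℕ → Option A) : List A :=
  (List.range (stOf α)).filterMap α

/-- `W_ω`: pseudo-infinite paths with stops (zeros encoded as `none`). -/
def Wom (W : Type) (R : W → W → Prop) (w0 : W) : Type :=
  {α : ℕ → Option W //
    (∃ m, ∀ k, m ≤ k → α k = none) ∧ (w0 :: zf α).Chain' R}

/-- `f₀` maps a pseudo-infinite path to its zero-free rooted path. -/
def fzero {W : Type} {R : W → W → Prop} {w0 : W} (α : Wom W R w0) : Unravel W R w0 :=
  ⟨w0 :: zf α.1, rfl, α.2.2⟩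

/-- the basic neighbourhoods `U_k(α)`. -/
def Uk {W : Type} {R : W → W → Prop} {w0 : W} (k : ℕ) (α : Wom W R w0) :
    Set (Wom W R w0) :=
  {β | (∀ i, i < max k (stOf α.1) → α.1 i = β.1 i) ∧ RSharp R w0 (fzero α) (fzero β)}

/-- the neighbourhood function of `N_ω(F)`: the filter generated by `{U_n(α) : n ∈ ℕ}`. -/
def tauOm {W : Type} (R : W → W → Prop) (w0 : W) (α : Wom W R w0) :
    Filter (Wom W R w0) :=
  ⨅ n : ℕ, Filter.principal (Uk n α)

/- ### Entanglement -/

def leftW {W1 W2 : Type} (l : List (W1 ⊕ W2)) : List W1 :=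
  l.filterMap (Sum.elim some fun _ => none)

def rightW {W1 W2 : Type} (l : List (W1 ⊕ W2)) : List W2 :=
  l.filterMap (Sum.elim (fun _ => none) some)

/-- the entanglement `F₁ ⋈ F₂`: words whose two projections (with roots prefixed)
are rooted paths. -/
def Ent {W1 W2 : Type} (R1 : W1 → W1 → Prop) (x0 : W1)
    (R2 : W2 → W2 → Prop) (y0 : W2) : Set (List (W1 ⊕ W2)) :=
  {x | (x0 :: leftW x).Chain' R1 ∧ (y0 :: rightW x).Chain' R2}

/-- `x ∼ y` iff `x = t·c`, `y = t·d` with `t` in the entanglement, `c, d ∈ W₁*`. -/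
def SimRel {W1 W2 : Type} (R1 : W1 → W1 → Prop) (x0 : W1)
    (R2 : W2 → W2 → Prop) (y0 : W2) (x y : List (W1 ⊕ W2)) : Prop :=
  ∃ t ∈ Ent R1 x0 R2 y0, ∃ c d : List W1,
    x = t ++ c.map Sum.inl ∧ y = t ++ d.map Sum.inl

/-- the `∼`-class `[x]` (within the entanglement). -/
def simCls {W1 W2 : Type} (R1 : W1 → W1 → Prop) (x0 : W1)
    (R2 : W2 → W2 → Prop) (y0 : W2) (x : List (W1 ⊕ W2)) : Set (List (W1 ⊕ W2)) :=
  {y | y ∈ Ent R1 x0 R2 y0 ∧ SimRel R1 x0 R2 y0 x y}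

/-- `D'_a`: elements of the entanglement whose first projection is `a`. -/
def Dprime {W1 W2 : Type} (R1 : W1 → W1 → Prop) (x0 : W1)
    (R2 : W2 → W2 → Prop) (y0 : W2) (a : Unravel W1 R1 x0) : Set (List (W1 ⊕ W2)) :=
  {x | x ∈ Ent R1 x0 R2 y0 ∧ x0 :: leftW x = a.1}

/-- `D^♯_a = {[x] : x ∈ D'_a}`. -/
def Dsharp {W1 W2 : Type} (R1 : W1 → W1 → Prop) (x0 : W1)
    (R2 : W2 → W2 → Prop) (y0 : W2) (a : Unravel W1 R1 x0) :
    Set (Set (List (W1 ⊕ W2))) :=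
  {S | ∃ x ∈ Dprime R1 x0 R2 y0 a, S = simCls R1 x0 R2 y0 x}

/-- `ℝ ∖ {0}`. -/
def Rnz : Type := {r : ℝ // r ≠ 0}

def y0R : Rnz := ⟨1, one_ne_zero⟩

/-- the total relation on `ℝ ∖ {0}` (the continuum S5 frame). -/
def TotR : Rnz → Rnz → Prop := fun _ _ => True

/- ### Predicate modal formulas and semantics -/

/-- Modal predicate formulas; `pred k n args` is the `k`-th `n`-ary predicate letter
applied to the variables `args`; variables are named by natural numbers. -/
inductive PF : Type
  | falsum : PF
  | pred : ℕ → (n : ℕ) → (Fin n → ℕ) → PF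
  | impl : PF → PF → PF
  | box : PF → PF
  | all : ℕ → PF → PF

def negPF (A : PF) : PF := .impl A .falsum
def exPF (x : ℕ) (A : PF) : PF := negPF (.all x (negPF A))

/-- satisfaction in a predicate Kripke model with expanding domains,
relative to an assignment `env` of elements to variables. -/
def pksat {W D : Type} (R : W → W → Prop) (Dom : W → Set D)
    (ξ : ℕ → (n : ℕ) → W → (Fin n → D) → Prop) :
    (ℕ → D) → W → PF → Prop
  | _, _, .falsum => False
  | env, u, .pred k n args => ξ k n u (fun i => env (args i))
  | env, u, .impl A B => pksat R Dom ξ env u A → pksat R Dom ξ env u B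
  | env, u, .box A => ∀ v, R u v → pksat R Dom ξ env v A
  | env, u, .all x A => ∀ a ∈ Dom u, pksat R Dom ξ (Function.update env x a) u A

/-- satisfaction in a predicate neighbourhood model with constant domain `Dstar`. -/
def pnsat {X Dstar : Type} (τ : X → Filter X)
    (θ : ℕ → (n : ℕ) → X → (Fin n → Dstar) → Prop) :
    (ℕ → Dstar) → X → PF → Prop
  | _, _, .falsum => False
  | env, x, .pred k n args => θ k n x (fun i => env (args i))
  | env, x, .impl A B => pnsat τ θ env x A → pnsat τ θ env x B
  | env, x, .box A => ∃ U ∈ τ x, ∀ y ∈ U, pnsat τ θ env y A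
  | env, x, .all v A => ∀ a : Dstar, pnsat τ θ (Function.update env v a) x A

/-- p-morphism of predicate Kripke frames with expanding domains:
a p-morphism of frames together with a compatible family of surjections between
the domains (encoded as total maps on the domain carriers). -/
def IsPredKPMorph {W W' D D' : Type} (R : W → W → Prop) (R' : W' → W' → Prop)
    (Dom : W → Set D) (Dom' : W' → Set D')
    (f : W → W') (g : W → D → D') : Prop :=
  IsPMorphismK R R' f ∧
  (∀ w, Set.MapsTo (g w) (Dom w) (Dom' (f w))) ∧
  (∀ w, Set.SurjOn (g w) (Dom w) (Dom' (f w))) ∧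
  (∀ w w', R w w' → ∀ d ∈ Dom w, g w d = g w' d)

/-- p-morphism from a predicate neighbourhood frame with constant domain `Dstar`
to a predicate Kripke frame with expanding domains. -/
def IsPredNPMorph {X W Dstar D : Type} (τ : X → Filter X)
    (R : W → W → Prop) (Dom : W → Set D)
    (f : X → W) (g : X → Dstar → D) : Prop :=
  IsPMorphismN τ (nbhdOf R) f ∧
  (∀ x (d : Dstar), g x d ∈ Dom (f x)) ∧
  (∀ x, ∀ e ∈ Dom (f x), ∃ d : Dstar, g x d = e) ∧
  (∀ (d : Dstar) (x : X), ∃ U ∈ τ x, ∀ y ∈ U, g y d = g x d)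

/- ### The map h -/

/-- fuel-driven version of the interleaving map `h`:
a nonzero letter of `γ` is emitted; a zero of `γ` consumes (and emits, unless it
is a zero) one letter of `α`. -/
def hAux {W A : Type} : ℕ → (ℕ → Option W) → (ℕ → Option A) → List (W ⊕ A)
  | 0, _, _ => []
  | n+1, α, γ =>
    match γ 0 with
    | some c => Sum.inr c :: hAux n α (fun i => γ (i+1))
    | none =>
      match α 0 with
      | some a => Sum.inl a :: hAux n (fun i => α (i+1)) (fun i => γ (i+1))
      | none => hAux n (fun i => α (i+1)) (fun i => γ (i+1))

/-- the map `h : W_ω × ℝ_ω → (W ∪ ℝ∖{0})*`. -/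
def hfun {W : Type} {R : W → W → Prop} {w0 : W}
    (α : Wom W R w0) (γ : Wom Rnz TotR y0R) : List (W ⊕ Rnz) :=
  hAux (stOf α.1 + stOf γ.1) α.1 γ.1

/- ### Normal modal logics -/

def substMF (σ : ℕ → MF) : MF → MF
  | .falsum => .falsum
  | .prop n => σ n
  | .impl A B => .impl (substMF σ A) (substMF σ B)
  | .box A => .box (substMF σ A)

def beval (v : ℕ → Prop) (b : MF → Prop) : MF → Prop
  | .falsum => False
  | .prop n => v n
  | .impl A B => beval v b A → beval v b B
  | .box A => b A

/-- classical propositional tautology (boxed formulas treated as atoms). -/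
def TautMF (A : MF) : Prop := ∀ v b, beval v b A

/-- derivability in the minimal normal modal logic with extra axioms `Ax`. -/
inductive KDer (Ax : Set MF) : MF → Prop
  | ax {A : MF} : A ∈ Ax → KDer Ax A
  | taut {A : MF} : TautMF A → KDer Ax A
  | normality (A B : MF) :
      KDer Ax (.impl (.box (.impl A B)) (.impl (.box A) (.box B)))
  | mp {A B : MF} : KDer Ax (.impl A B) → KDer Ax A → KDer Ax B
  | nec {A : MF} : KDer Ax A → KDer Ax (.box A)
  | subst {A : MF} (σ : ℕ → MF) : KDer Ax A → KDer Ax (substMF σ A)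

/-- the axioms `□p → □^k p` for `k ∈ K`. -/
def ptcAxiomSet (K : Set ℕ) : Set MF := {A | ∃ k ∈ K, A = ptcAxiom k}

/- ### Universal strict Horn sentences -/

/-- quantifier-free positive formulas in the signature of one binary relation. -/
inductive PosF : Type
  | atom : ℕ → ℕ → PosF
  | conj : PosF → PosF → PosF
  | disj : PosF → PosF → PosF

def PosF.sat {V : Type} (S : V → V → Prop) (env : ℕ → V) : PosF → Prop
  | .atom i j => S (env i) (env j)
  | .conj A B => PosF.sat S env A ∧ PosF.sat S env B
  | .disj A B => PosF.sat S env A ∨ PosF.sat S env B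

/-- a universal strict Horn sentence `∀ ... (φ → R x y)`. -/
structure Horn : Type where
  hyp : PosF
  cx : ℕ
  cy : ℕ

def Horn.Holds {V : Type} (φ : Horn) (S : V → V → Prop) : Prop :=
  ∀ env : ℕ → V, PosF.sat S env φ.hyp → S (env φ.cx) (env φ.cy)

/-- the `Γ`-closure `S^Γ`: the least relation containing `S` and validating `Γ`. -/
def hornClosure {V : Type} (Γ : Set Horn) (S : V → V → Prop) : V → V → Prop :=
  fun a b => ∀ T : V → V → Prop,
    (∀ x y, S x y → T x y) → (∀ φ ∈ Γ, φ.Holds T) → T a b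

/-- a Horn sentence corresponds to the axiom `□p → □^k p` if it defines exactly the
frames validating that axiom. -/
def Corresponds (φ : Horn) (k : ℕ) : Prop :=
  ∀ (V : Type) (S : V → V → Prop),
    φ.Holds S ↔ ∀ (Val : ℕ → Set V) (x : V), ksat S Val x (ptcAxiom k)

/-- `U^Γ_k(α)`. -/
def UkG {W : Type} {R : W → W → Prop} {w0 : W} (Γ : Set Horn) (k : ℕ)
    (α : Wom W R w0) : Set (Wom W R w0) :=
  {β | (∀ i, i < max k (stOf α.1) → α.1 i = β.1 i) ∧
        hornClosure Γ (RSharp R w0) (fzero α) (fzero β)}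

/-- the neighbourhood function of `N^Γ_ω(F)`. -/
def tauG {W : Type} (R : W → W → Prop) (w0 : W) (Γ : Set Horn)
    (α : Wom W R w0) : Filter (Wom W R w0) :=
  ⨅ n : ℕ, Filter.principal (UkG Γ n α)

/- ### Quantified modal logic QL -/

/-- substitution of predicate formulas for the letters of a propositional formula. -/
def psubst (σ : ℕ → PF) : MF → PF
  | .falsum => .falsum
  | .prop n => σ n
  | .impl A B => .impl (psubst σ A) (psubst σ B)
  | .box A => .box (psubst σ A)

def FreeIn (x : ℕ) : PF → Prop
  | .falsum => False
  | .pred _ _ args => ∃ i, args i = x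
  | .impl A B => FreeIn x A ∨ FreeIn x B
  | .box A => FreeIn x A
  | .all z A => z ≠ x ∧ FreeIn x A

/-- substitution of variable `y` for the free occurrences of variable `x`. -/
def subV (x y : ℕ) : PF → PF
  | .falsum => .falsum
  | .pred k n args => .pred k n (fun i => if args i = x then y else args i)
  | .impl A B => .impl (subV x y A) (subV x y B)
  | .box A => .box (subV x y A)
  | .all z A => if z = x then .all z A else .all z (subV x y A)

/-- `y` is substitutable for `x` (no capture). -/
def FreeFor (y x : ℕ) : PF → Prop
  | .falsum => True
  | .pred _ _ _ => True
  | .impl A B => FreeFor y x A ∧ FreeFor y x B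
  | .box A => FreeFor y x A
  | .all z A => x = z ∨ ((z = y → ¬ FreeIn x A) ∧ FreeFor y x A)

/-- derivability in the minimal predicate modal logic `QL` over the propositional
logic axiomatized by `Ax`. -/
inductive QLDer (Ax : Set MF) : PF → Prop
  | propInst {A : MF} (σ : ℕ → PF) : KDer Ax A → QLDer Ax (psubst σ A)
  | allElim (x y : ℕ) (A : PF) (h : FreeFor y x A) :
      QLDer Ax (.impl (.all x A) (subV x y A))
  | allShift (x : ℕ) (A B : PF) (h : ¬ FreeIn x B) :
      QLDer Ax (.impl (.all x (.impl B A)) (.impl B (.all x A)))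
  | exShift (x : ℕ) (A B : PF) (h : ¬ FreeIn x B) :
      QLDer Ax (.impl (.all x (.impl A B)) (.impl (exPF x A) B))
  | mp {A B : PF} : QLDer Ax (.impl A B) → QLDer Ax A → QLDer Ax B
  | nec {A : PF} : QLDer Ax A → QLDer Ax (.box A)
  | gen {A : PF} (x : ℕ) : QLDer Ax A → QLDer Ax (.all x A)

/-- a predicate neighbourhood frame with constant domain. -/
structure PredNFrame : Type 1 where
  X : Type
  tau : X → Filter X
  D : Type
  hD : Nonempty D

/-- validity of a predicate formula (i.e. of its universal closure) on a predicate
neighbourhood frame with constant domain. -/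
def PredNFrame.Valid (F : PredNFrame) (A : PF) : Prop :=
  ∀ (θ : ℕ → (n : ℕ) → F.X → (Fin n → F.D) → Prop) (env : ℕ → F.D) (x : F.X),
    pnsat F.tau θ env x A

end

/-- The bound `stOf α` in `zf α` may be replaced by any bound past which `α` vanishes. -/
theorem zf_eq_filterMap_range {A : Type} {α : ℕ → Option A} {n : ℕ}
    (h : ∀ k, n ≤ k → α k = none) : zf α = (List.range n).filterMap α := by
  have hst : ∀ k, stOf α ≤ k → α k = none :=
    Nat.sInf_mem (s := {m | ∀ k, m ≤ k → α k = none}) ⟨n, h⟩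
  have hle : stOf α ≤ n := Nat.sInf_le (s := {m | ∀ k, m ≤ k → α k = none}) h
  obtain ⟨d, rfl⟩ := Nat.exists_eq_add_of_le hle
  have htail : ((List.range d).map (stOf α + ·)).filterMap α = [] := by
    simp [hst]
  rw [List.range_add, List.filterMap_append, htail, List.append_nil]
  rfl

theorem Wom.eq_none_of_stOf_le {W : Type} {R : W → W → Prop} {w0 : W} (α : Wom W R w0)
    {k : ℕ} (hk : stOf α.1 ≤ k) : α.1 k = none :=
  Nat.sInf_mem (s := {m | ∀ k, m ≤ k → α.1 k = none}) α.2.1 k hk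

theorem zf_getElem? {A : Type} (l : List A) : zf (fun i => l[i]?) = l := by
  rw [zf_eq_filterMap_range (n := l.length) fun k hk => List.getElem?_eq_none hk]
  induction l using List.reverseRecOn with
  | nil => rfl
  | append_singleton l a ih =>
    rw [List.length_append, List.length_singleton, List.range_succ, List.filterMap_append]
    conv_rhs => rw [← ih]
    congr 1
    · refine List.filterMap_congr fun i hi => ?_
      exact List.getElem?_append_left (List.mem_range.mp hi)
    · simp

/-- Writing one letter past the end of a sequence appends it to the zero-free part. -/
theorem zf_update {A : Type} {α : ℕ → Option A} {n : ℕ}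
    (h : ∀ k, n ≤ k → α k = none) (v : A) :
    zf (Function.update α n (some v)) = zf α ++ [v] := by
  have hn : ∀ k, n + 1 ≤ k → Function.update α n (some v) k = none := fun k hk => by
    rw [Function.update_of_ne (by omega), h k (by omega)]
  rw [zf_eq_filterMap_range hn, zf_eq_filterMap_range h, List.range_succ,
    List.filterMap_append]
  congr 1
  · refine List.filterMap_congr fun i hi => ?_
    rw [Function.update_of_ne (List.mem_range.mp hi).ne]
  · simp

theorem fzero_surjective {W : Type} (R : W → W → Prop) (w0 : W) :
    Function.Surjective (fzero : Wom W R w0 → Unravel W R w0) := by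
  rintro ⟨_ | ⟨a, t⟩, hhead, hchain⟩
  · simp at hhead
  · obtain rfl : a = w0 := by simpa using hhead
    refine ⟨⟨fun i => t[i]?, ⟨t.length, fun k hk => List.getElem?_eq_none hk⟩, ?_⟩, ?_⟩
    · rwa [zf_getElem?]
    · exact Subtype.ext (congrArg (a :: ·) (zf_getElem? t))

/-- Every one-step extension of `fzero α` has a preimage in each `Uk k α`. -/
theorem exists_mem_Uk_fzero_eq {W : Type} {R : W → W → Prop} {w0 : W} (k : ℕ)
    (α : Wom W R w0) {q : Unravel W R w0} (hq : RSharp R w0 (fzero α) q) :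
    ∃ β ∈ Uk k α, fzero β = q := by
  obtain ⟨v, hv, -⟩ := id hq
  set m := max k (stOf α.1)
  have hα : ∀ i, m ≤ i → α.1 i = none := fun i hi =>
    α.eq_none_of_stOf_le ((le_max_right _ _).trans hi)
  have hzf : w0 :: zf (Function.update α.1 m (some v)) = q.1 := by
    rw [zf_update hα, hv]
    rfl
  let β : Wom W R w0 := ⟨Function.update α.1 m (some v),
    ⟨m + 1, fun i hi => by rw [Function.update_of_ne (by omega), hα i (by omega)]⟩,
    hzf ▸ q.2.2⟩
  have hβ : fzero β = q := Subtype.ext hzf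
  exact ⟨β, ⟨fun i hi => (Function.update_of_ne hi.ne _ _).symm, hβ ▸ hq⟩, hβ⟩

theorem mem_tauOm {W : Type} {R : W → W → Prop} {w0 : W} {α : Wom W R w0}
    {U : Set (Wom W R w0)} : U ∈ tauOm R w0 α ↔ ∃ n, Uk n α ⊆ U := by
  have hanti : Antitone fun n => Uk n α := fun m n hmn _ hβ =>
    ⟨fun i hi => hβ.1 i (hi.trans_le (max_le_max_right _ hmn)), hβ.2⟩
  rw [tauOm, Filter.mem_iInf_of_directed]
  · rfl
  · exact (Filter.monotone_principal.comp_antitone hanti).directed_ge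

/-- `f₀` is a p-morphism of n-frames from `N_ω(F)` onto `N(F^♯)`. -/
theorem fzero_npmorphism {W : Type} (R : W → W → Prop) (w0 : W)
    (hroot : IsRootedAt R w0) :
    IsPMorphismN (tauOm R w0) (nbhdOf (RSharp R w0))
      (fzero : Wom W R w0 → Unravel W R w0) := by
  refine ⟨fzero_surjective R w0, fun α U hU => ?_, fun α V hV => ?_⟩
  · obtain ⟨n, hn⟩ := mem_tauOm.mp hU
    intro q hq
    obtain ⟨β, hβ, rfl⟩ := exists_mem_Uk_fzero_eq n α hq
    exact Set.mem_image_of_mem _ (hn hβ)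
  · exact mem_tauOm.mpr ⟨0, fun β hβ => hV hβ.2⟩
end

section
/- Let F₁ = (W₁, R₁) and F₂ = (W₂, R₂) be rooted Kripke frames. The relation ∼ on the entanglement F₁ ⋈ F₂, defined by x ∼ y iff there exist t ∈ F₁ ⋈ F₂ and words c, d ∈ W₁* with x = t·c and y = t·d, is an equivalence relation. -/
open Classical

/-- `∼` is transitive: of the two common prefixes one extends the other by a word over `W₁`. -/
theorem SimRel.trans {W1 W2 : Type} {R1 : W1 → W1 → Prop} {x0 : W1}
    {R2 : W2 → W2 → Prop} {y0 : W2} {x y z : List (W1 ⊕ W2)}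
    (hxy : SimRel R1 x0 R2 y0 x y) (hyz : SimRel R1 x0 R2 y0 y z) :
    SimRel R1 x0 R2 y0 x z := by
  obtain ⟨t, ht, c, d, rfl, rfl⟩ := hxy
  obtain ⟨s, hs, e, f, hse, rfl⟩ := hyz
  rcases List.append_eq_append_iff.mp hse with ⟨a, rfl, ha⟩ | ⟨a, rfl, ha⟩
  · obtain ⟨a, _, rfl, rfl, -⟩ := List.map_eq_append_iff.mp ha
    exact ⟨t, ht, c, a ++ f, rfl, by simp⟩
  · obtain ⟨a, _, rfl, rfl, -⟩ := List.map_eq_append_iff.mp ha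
    exact ⟨s, hs, a ++ c, f, by simp, rfl⟩

/-- `∼` is an equivalence relation on the entanglement `F₁ ⋈ F₂`. -/
theorem simRel_equivalence {W1 W2 : Type}
    (R1 : W1 → W1 → Prop) (x0 : W1) (hr1 : IsRootedAt R1 x0)
    (R2 : W2 → W2 → Prop) (y0 : W2) (hr2 : IsRootedAt R2 y0) :
    Equivalence (fun x y : ↥(Ent R1 x0 R2 y0) => SimRel R1 x0 R2 y0 x.1 y.1) := by
  refine ⟨fun x => ⟨x.1, x.2, [], [], by simp, by simp⟩, ?_, SimRel.trans⟩
  rintro x y ⟨t, ht, c, d, hx, hy⟩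
  exact ⟨t, ht, d, c, hy, hx⟩
end

section
/- Let (F, D) be a predicate Kripke frame with expanding domains such that F = (W, R) is a tree (there is a unique path from the root to each point) and every domain D_u has cardinality at most the continuum. Let G be the S5 frame on ℝ∖{0} and let pF^♯ = (F^♯, D^♯) with domains D^♯_a built from the entanglement F ⋈ G. Then there is a family ψ = (ψ_a)_{a ∈ W^♯} of surjections ψ_a : D^♯_a → D_{π(a)} such that (π, ψ) is a p-morphism of predicate Kripke frames from pF^♯ onto (F, D). -/
open Classical

/-- Reading a word from left to right, keep track of the current point of `W` and of the element
`f u r` determined by the last letter `r` of the second alphabet, where `u` was current. -/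
def entStep {W A U : Type} (f : W → A → U) (s : W × U) : W ⊕ A → W × U
  | .inl w => (w, s.2)
  | .inr r => (s.1, f s.1 r)

/-- The element of the domain determined by a word. -/
def entValue {W A U : Type} (f : W → A → U) (s : W × U) (x : List (W ⊕ A)) : U :=
  (x.foldl (entStep f) s).2

theorem leftW_append {W A : Type} (x y : List (W ⊕ A)) :
    leftW (x ++ y) = leftW x ++ leftW y :=
  List.filterMap_append

theorem leftW_map_inl {W A : Type} (l : List W) :
    leftW (l.map (Sum.inl : W → W ⊕ A)) = l := by
  induction l with
  | nil => rfl
  | cons a l ih => exact congrArg (a :: ·) ih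

theorem foldl_entStep_fst {W A U : Type} (f : W → A → U) (x : List (W ⊕ A)) (s : W × U) :
    (x.foldl (entStep f) s).1 = (s.1 :: leftW x).getLast (List.cons_ne_nil _ _) := by
  induction x generalizing s with
  | nil => rfl
  | cons a x ih =>
    cases a with
    | inl w =>
      exact (ih _).trans (List.getLast_cons (a := s.1) (List.cons_ne_nil w (leftW x))).symm
    | inr r => exact ih _

theorem entValue_mem {W A U : Type} {R : W → W → Prop} {D : W → Set U}
    (hexp : ∀ u v, R u v → D u ⊆ D v) {f : W → A → U} (hf : ∀ u r, f u r ∈ D u)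
    (x : List (W ⊕ A)) (s : W × U) (hs : s.2 ∈ D s.1)
    (hx : List.IsChain R (s.1 :: leftW x)) :
    entValue f s x ∈ D (x.foldl (entStep f) s).1 := by
  induction x generalizing s with
  | nil => exact hs
  | cons a x ih =>
    cases a with
    | inl w =>
      have hx' : List.IsChain R (s.1 :: w :: leftW x) := hx
      rw [List.isChain_cons_cons] at hx'
      exact ih (w, s.2) (hexp _ _ hx'.1 hs) hx'.2
    | inr r => exact ih (s.1, f s.1 r) (hf _ _) hx

theorem entValue_append_map_inl {W A U : Type} (f : W → A → U) (s : W × U)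
    (x : List (W ⊕ A)) (c : List W) :
    entValue f s (x ++ c.map Sum.inl) = entValue f s x := by
  induction c generalizing x with
  | nil => simp
  | cons w c ih =>
    have h := ih (x ++ [Sum.inl w])
    rw [List.append_assoc] at h
    refine h.trans ?_
    simp [entValue, entStep]

theorem entValue_append_inr {W A U : Type} (f : W → A → U) (s : W × U)
    (x : List (W ⊕ A)) (r : A) :
    entValue f s (x ++ [Sum.inr r]) = f (x.foldl (entStep f) s).1 r := by
  simp [entValue, entStep]

theorem SimRel.entValue_eq {W A U : Type} {R₁ : W → W → Prop} {x₀ : W}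
    {R₂ : A → A → Prop} {y₀ : A} {x y : List (W ⊕ A)} (h : SimRel R₁ x₀ R₂ y₀ x y)
    (f : W → A → U) (s : W × U) : entValue f s x = entValue f s y := by
  obtain ⟨t, -, c, d, rfl, rfl⟩ := h
  rw [entValue_append_map_inl, entValue_append_map_inl]

theorem mem_simCls_self {W A : Type} {R₁ : W → W → Prop} {x₀ : W}
    {R₂ : A → A → Prop} {y₀ : A} {x : List (W ⊕ A)} (hx : x ∈ Ent R₁ x₀ R₂ y₀) :
    x ∈ simCls R₁ x₀ R₂ y₀ x :=
  ⟨hx, x, hx, [], [], by simp, by simp⟩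

/-- The value shared by all members of a `∼`-class. -/
noncomputable def clsValue {W A U : Type} (f : W → A → U) (s : W × U) (S : Set (List (W ⊕ A))) : U :=
  if h : S.Nonempty then entValue f s h.some else s.2

theorem clsValue_simCls {W A U : Type} {R₁ : W → W → Prop} {x₀ : W}
    {R₂ : A → A → Prop} {y₀ : A} {x : List (W ⊕ A)} (hx : x ∈ Ent R₁ x₀ R₂ y₀)
    (f : W → A → U) (s : W × U) :
    clsValue f s (simCls R₁ x₀ R₂ y₀ x) = entValue f s x := by
  have h : (simCls R₁ x₀ R₂ y₀ x).Nonempty := ⟨x, mem_simCls_self hx⟩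
  rw [clsValue, dif_pos h]
  exact (h.some_mem.2.entValue_eq f s).symm

theorem mk_Rnz : Cardinal.mk Rnz = Cardinal.continuum := by
  have h := Cardinal.mk_compl_of_infinite ({0} : Set ℝ) (by
    rw [Cardinal.mk_singleton, Cardinal.mk_real]
    exact Cardinal.one_lt_aleph0.trans Cardinal.aleph0_lt_continuum)
  rw [Cardinal.mk_real] at h
  exact h

/-- A nonempty set of cardinality at most the continuum is the range of a map from `ℝ ∖ {0}`. -/
theorem exists_Rnz_range_eq {U : Type} {S : Set U} (hne : S.Nonempty)
    (hS : Cardinal.mk S ≤ Cardinal.continuum) : ∃ g : Rnz → U, Set.range g = S := by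
  rw [← mk_Rnz] at hS
  obtain ⟨e⟩ := hS
  have := hne.to_subtype
  refine ⟨fun r => (Function.invFun e r : S), ?_⟩
  have hsurj : Function.Surjective (Function.invFun e) := Function.invFun_surjective e.injective
  change Set.range (Subtype.val ∘ Function.invFun e) = S
  rw [hsurj.range_comp, Subtype.range_coe]

theorem isChain_TotR (l : List Rnz) : List.IsChain TotR l := by
  induction l with
  | nil => exact .nil
  | cons a l ih => cases l with
    | nil => exact .singleton _
    | cons b l => exact .cons_cons trivial ih

theorem Dprime.foldl_fst {W A U : Type} {R₁ : W → W → Prop} {x₀ : W}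
    {R₂ : A → A → Prop} {y₀ : A} {a : Unravel W R₁ x₀} {x : List (W ⊕ A)}
    (hx : x ∈ Dprime R₁ x₀ R₂ y₀ a) (f : W → A → U) (d : U) :
    (x.foldl (entStep f) (x₀, d)).1 = a.last := by
  rw [foldl_entStep_fst]
  simp only [Unravel.last, ← hx.2]

theorem Unravel.exists_append_inr_mem_Dprime {W : Type} {R : W → W → Prop} {w₀ : W}
    (a : Unravel W R w₀) (r : Rnz) :
    ∃ x, x ++ [Sum.inr r] ∈ Dprime R w₀ TotR y0R a ∧ x ∈ Dprime R w₀ TotR y0R a := by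
  obtain ⟨_ | ⟨w, l⟩, hhead, hchain⟩ := a
  · simp at hhead
  · obtain rfl : w = w₀ := by simpa using hhead
    have hl : leftW (l.map Sum.inl ++ [Sum.inr r]) = l := by
      rw [leftW_append, leftW_map_inl]
      exact List.append_nil l
    refine ⟨l.map Sum.inl, ⟨⟨?_, isChain_TotR _⟩, ?_⟩, ⟨?_, isChain_TotR _⟩, ?_⟩
    · rw [hl]; exact hchain
    · rw [hl]
    · rw [leftW_map_inl]; exact hchain
    · rw [leftW_map_inl]

theorem Unravel.last_eq_of_eq_append {W : Type} {R : W → W → Prop} {w₀ : W} {p q : Unravel W R w₀}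
    {v : W} (h : q.1 = p.1 ++ [v]) : q.last = v := by
  simp only [Unravel.last, h, List.getLast_append_singleton]

theorem Unravel.isPMorphismK_last {W : Type} {R : W → W → Prop} {w₀ : W}
    (hsurj : Function.Surjective (Unravel.last : Unravel W R w₀ → W)) :
    IsPMorphismK (RSharp R w₀) R Unravel.last := by
  refine ⟨hsurj, ?_, ?_⟩
  · rintro p q ⟨v, hq, hR⟩
    rwa [Unravel.last_eq_of_eq_append hq]
  · intro p v hR
    have hp : p.1 ≠ [] := fun h => by simpa [h] using p.2.1
    let q : Unravel W R w₀ := ⟨p.1 ++ [v], by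
      refine ⟨by rw [List.head?_append_of_ne_nil _ hp]; exact p.2.1, ?_⟩
      refine List.IsChain.append p.2.2 (.singleton v) ?_
      intro x hx y hy
      rw [List.getLast?_eq_getLast_of_ne_nil hp] at hx
      obtain rfl : p.last = x := Option.some.inj hx
      obtain rfl : v = y := by simpa using hy
      exact hR⟩
    exact ⟨q, ⟨v, rfl, hR⟩, Unravel.last_eq_of_eq_append (p := p) rfl⟩

/-- for a tree `F` with (nonempty) domains of cardinality at most
continuum, there is a family of surjections `ψ` making `(π, ψ)` a p-morphism of
predicate Kripke frames from `pF^♯ = (F^♯, D^♯)` onto `(F, D)`. -/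
theorem exists_psi_pred_pmorphism {W U : Type} (R : W → W → Prop) (w0 : W)
    (hroot : IsRootedAt R w0)
    (htree : ∀ w : W, ∃! p : Unravel W R w0, p.last = w)
    (D : W → Set U)
    (hexp : ∀ u v, R u v → D u ⊆ D v)
    (hne : ∀ u, (D u).Nonempty)
    (hcard : ∀ u, Cardinal.mk (D u) ≤ Cardinal.continuum) :
    ∃ ψ : Unravel W R w0 → Set (List (W ⊕ Rnz)) → U,
      IsPredKPMorph (RSharp R w0) R (Dsharp R w0 TotR y0R) D Unravel.last ψ := by
  choose f hf using fun u => exists_Rnz_range_eq (hne u) (hcard u)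
  have hfD : ∀ u r, f u r ∈ D u := fun u r => hf u ▸ Set.mem_range_self r
  obtain ⟨d₀, hd₀⟩ := hne w0
  refine ⟨fun _ => clsValue f (w0, d₀),
    Unravel.isPMorphismK_last fun w => (htree w).exists, ?_, ?_, fun _ _ _ _ _ => rfl⟩
  · rintro a _ ⟨x, hx, rfl⟩
    change clsValue f (w0, d₀) _ ∈ _
    rw [clsValue_simCls hx.1, ← Dprime.foldl_fst hx f d₀]
    exact entValue_mem hexp hfD x (w0, d₀) hd₀ hx.1.1
  · intro a e he
    rw [← hf a.last] at he
    obtain ⟨r, rfl⟩ := he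
    obtain ⟨x, hxr, hx⟩ := a.exists_append_inr_mem_Dprime r
    refine ⟨_, ⟨_, hxr, rfl⟩, ?_⟩
    change clsValue f (w0, d₀) _ = _
    rw [clsValue_simCls hxr.1, entValue_append_inr, Dprime.foldl_fst hx]
end

section
/- Let pX = (X, τ, D*) be a predicate neighbourhood frame with constant domain, pF = (W, R, D) a predicate Kripke frame with expanding domains, (φ₀, φ₁) : pX → pF a p-morphism, and ξ a valuation on pF. Define the valuation θ on pX by (a₁, …, a_m) ∈ θ_x(P) iff (φ_{1x}(a₁), …, φ_{1x}(a_m)) ∈ ξ_{φ₀(x)}(P). Then for every x ∈ X and every modal predicate formula A: (pX, θ), x ⊨ ∀̄A if and only if (pF, ξ), φ₀(x) ⊨ ∀̄A, where ∀̄A is the universal closure of A. -/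
open Classical

theorem finite_setOf_freeIn (A : PF) : {i | FreeIn i A}.Finite := by
  induction A with
  | falsum => simp [FreeIn]
  | pred k n args => exact Set.finite_range args
  | impl A B ihA ihB => exact ihA.union ihB
  | box A ih => exact ih
  | all z A ih => exact ih.subset fun i hi => hi.2

theorem pksat_congr {W D : Type} (R : W → W → Prop) (Dom : W → Set D)
    (ξ : ℕ → (n : ℕ) → W → (Fin n → D) → Prop) (A : PF) {e e' : ℕ → D}
    (h : ∀ i, FreeIn i A → e i = e' i) (u : W) :
    pksat R Dom ξ e u A ↔ pksat R Dom ξ e' u A := by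
  induction A generalizing e e' u with
  | falsum => rfl
  | pred k n args =>
    have : (fun i => e (args i)) = fun i => e' (args i) :=
      funext fun i => h _ ⟨i, rfl⟩
    simp only [pksat, this]
  | impl A B ihA ihB =>
    exact imp_congr (ihA (fun i hi => h i (.inl hi)) u) (ihB (fun i hi => h i (.inr hi)) u)
  | box A ih => exact forall₂_congr fun v _ => ih h v
  | all z A ih =>
    refine forall₂_congr fun a _ => ih (fun i hi => ?_) u
    rcases eq_or_ne i z with rfl | hz
    · simp
    · simpa [hz] using h i ⟨hz.symm, hi⟩

/-- Truth at a point is preserved and reflected when an assignment is pushed forward along the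
domain map at that point. -/
theorem IsPredNPMorph.pnsat_iff_pksat {X W Dstar D : Type} {τ : X → Filter X}
    {R : W → W → Prop} {Dom : W → Set D} {φ0 : X → W} {φ1 : X → Dstar → D}
    (hmor : IsPredNPMorph τ R Dom φ0 φ1)
    (ξ : ℕ → (n : ℕ) → W → (Fin n → D) → Prop) (A : PF) (env : ℕ → Dstar) (x : X) :
    pnsat τ (fun k n x as => ξ k n (φ0 x) (fun i => φ1 x (as i))) env x A ↔
      pksat R Dom ξ (fun i => φ1 x (env i)) (φ0 x) A := by
  obtain ⟨⟨-, himage, hpreimage⟩, hmem, hsurj, hlocal⟩ := hmor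
  induction A generalizing env x with
  | falsum => rfl
  | pred k n args => rfl
  | impl A B ihA ihB => exact imp_congr (ihA env x) (ihB env x)
  | box A ih =>
    have hagree : {y | ∀ i ∈ {i | FreeIn i A}, φ1 y (env i) = φ1 x (env i)} ∈ τ x := by
      refine (Filter.eventually_all_finite (finite_setOf_freeIn A)).2 fun i _ => ?_
      obtain ⟨U, hU, hUeq⟩ := hlocal (env i) x
      exact Filter.mem_of_superset hU hUeq
    constructor
    · rintro ⟨U, hU, hUA⟩ v hv
      obtain ⟨y, ⟨hyU, hy⟩, rfl⟩ := himage x _ (Filter.inter_mem hU hagree) hv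
      exact (pksat_congr R Dom ξ A hy _).1 ((ih env y).1 (hUA y hyU))
    · intro h
      refine ⟨_, Filter.inter_mem (hpreimage x _ (Filter.mem_principal_self _)) hagree, ?_⟩
      rintro y ⟨hRy, hy⟩
      exact (ih env y).2 ((pksat_congr R Dom ξ A hy _).2 (h _ hRy))
  | all z A ih =>
    have hupdate (a : Dstar) : (fun i => φ1 x (Function.update env z a i)) =
        Function.update (fun i => φ1 x (env i)) z (φ1 x a) :=
      Function.comp_update (φ1 x) env z a
    constructor
    · intro h e he
      obtain ⟨a, rfl⟩ := hsurj x e he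
      exact hupdate a ▸ (ih _ x).1 (h a)
    · intro h a
      exact (ih _ x).2 (hupdate a ▸ h _ (hmem x a))

/-- p-morphism lemma from a predicate neighbourhood frame with
constant domain to a predicate Kripke frame with expanding domains: universal
closures are preserved and reflected. -/
theorem pred_pmorphism_lemma {X W Dstar D : Type} [Nonempty Dstar]
    (τ : X → Filter X) (R : W → W → Prop) (Dom : W → Set D)
    (hexp : ∀ u v, R u v → Dom u ⊆ Dom v)
    (φ0 : X → W) (φ1 : X → Dstar → D)
    (hmor : IsPredNPMorph τ R Dom φ0 φ1)
    (ξ : ℕ → (n : ℕ) → W → (Fin n → D) → Prop)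
    (hval : ∀ k n u as, ξ k n u as → ∀ i, as i ∈ Dom u)
    (θ : ℕ → (n : ℕ) → X → (Fin n → Dstar) → Prop)
    (hθ : θ = fun k n x as => ξ k n (φ0 x) (fun i => φ1 x (as i))) :
    ∀ (x : X) (A : PF),
      (∀ env : ℕ → Dstar, pnsat τ θ env x A) ↔
      (∀ env : ℕ → D, (∀ i, env i ∈ Dom (φ0 x)) →
          pksat R Dom ξ env (φ0 x) A) := by
  subst hθ
  refine fun x A => ⟨fun h env henv => ?_, fun h env => ?_⟩
  · choose env' henv' using fun i => hmor.2.2.1 x (env i) (henv i)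
    obtain rfl : (fun i => φ1 x (env' i)) = env := funext henv'
    exact (hmor.pnsat_iff_pksat ξ A env' x).1 (h env')
  · exact (hmor.pnsat_iff_pksat ξ A env x).2 (h _ fun i => hmor.2.1 x (env i))
end

section
/- Let F = (W, R) be a rooted Kripke frame, G the S5 frame on ℝ∖{0}, pX = (N_ω(F), D*) with constant domain D* the set of pseudo-infinite paths over ℝ∖{0}, and pF^♯ = (F^♯, D^♯) the predicate Kripke frame built from the entanglement F ⋈ G. Then the pair (f₀, ξ), where ξ_α(γ) = [h(α, γ)], is a p-morphism from pX to pF^♯. -/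
open Classical

namespace Entanglement

section Sequences

variable {A W : Type}

/-- `α` is zero from position `m` on. -/
def ZeroFrom (m : ℕ) (α : ℕ → Option A) : Prop := ∀ k, m ≤ k → α k = none

/-- The nonzero letters among the first `m` letters of `α`. -/
def zeroFree (m : ℕ) (α : ℕ → Option A) : List A := (List.range m).filterMap α

/-- `α` with its first letter removed. -/
def tail (α : ℕ → Option A) : ℕ → Option A := fun i => α (i + 1)

/-- `x` followed by `α`. -/
def cons (x : Option A) (α : ℕ → Option A) : ℕ → Option A
  | 0 => x
  | i + 1 => α i

@[simp] lemma tail_cons (x : Option A) (α : ℕ → Option A) : tail (cons x α) = α := rfl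

@[simp] lemma cons_zero (x : Option A) (α : ℕ → Option A) : cons x α 0 = x := rfl

lemma ZeroFrom.tail {m : ℕ} {α : ℕ → Option A} (h : ZeroFrom m α) :
    ZeroFrom (m - 1) (tail α) := fun k hk => h (k + 1) (by omega)

lemma ZeroFrom.cons {m : ℕ} {α : ℕ → Option A} (h : ZeroFrom m α) (x : Option A) :
    ZeroFrom (m + 1) (cons x α) := by
  rintro (_ | k) hk
  · omega
  · exact h k (by omega)

lemma ZeroFrom.pos {m : ℕ} {α : ℕ → Option A} (h : ZeroFrom m α) {x : A} (hx : α 0 = some x) :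
    0 < m := by
  by_contra hm
  simp [h 0 (by omega)] at hx

lemma zeroFrom_stOf {α : ℕ → Option A} (h : ∃ m, ZeroFrom m α) : ZeroFrom (stOf α) α :=
  Nat.sInf_mem (s := {m | ∀ k, m ≤ k → α k = none}) h

lemma zeroFree_succ (m : ℕ) (α : ℕ → Option A) :
    zeroFree (m + 1) α = (α 0).toList ++ zeroFree m (tail α) := by
  unfold zeroFree
  rw [List.range_succ_eq_map, List.filterMap_cons, List.filterMap_map]
  cases α 0 <;> rfl

lemma zeroFree_succ_last (m : ℕ) (α : ℕ → Option A) :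
    zeroFree (m + 1) α = zeroFree m α ++ (α m).toList := by
  unfold zeroFree
  rw [List.range_succ, List.filterMap_append]
  cases h : α m <;> simp [h]

lemma ZeroFrom.zeroFree_eq_of_le {m n : ℕ} {α : ℕ → Option A} (h : ZeroFrom m α) (hmn : m ≤ n) :
    zeroFree n α = zeroFree m α := by
  induction n, hmn using Nat.le_induction with
  | base => rfl
  | succ n hn ih => rw [zeroFree_succ_last, ih, h n hn]; simp

lemma ZeroFrom.zf_eq {m : ℕ} {α : ℕ → Option A} (h : ZeroFrom m α) : zf α = zeroFree m α :=
  ((zeroFrom_stOf ⟨m, h⟩).zeroFree_eq_of_le (Nat.sInf_le h)).symm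

lemma ZeroFrom.zeroFree_eq {m : ℕ} {α : ℕ → Option A} (h : ZeroFrom m α) :
    zeroFree m α = (α 0).toList ++ zeroFree (m - 1) (Entanglement.tail α) := by
  cases m with
  | zero => simp [h 0 le_rfl, zeroFree]
  | succ m => exact zeroFree_succ m α

lemma zeroFree_congr {m : ℕ} {α β : ℕ → Option A} (h : ∀ i, i < m → α i = β i) :
    zeroFree m α = zeroFree m β := by
  induction m with
  | zero => rfl
  | succ m ih =>
    rw [zeroFree_succ_last, zeroFree_succ_last, ih fun i hi => h i (by omega), h m (by omega)]

lemma zeroFree_getElem? (l : List A) : zeroFree l.length (fun i => l[i]?) = l := by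
  induction l with
  | nil => rfl
  | cons a l ih =>
    rw [List.length_cons, zeroFree_succ]
    exact congrArg (List.cons a) ih

lemma hAux_succ_some {n : ℕ} {α : ℕ → Option W} {γ : ℕ → Option A} {c : A} (h : γ 0 = some c) :
    hAux (n + 1) α γ = Sum.inr c :: hAux n α (tail γ) := by
  simp only [hAux, h]
  rfl

lemma hAux_succ_none {n : ℕ} {α : ℕ → Option W} {γ : ℕ → Option A} (h : γ 0 = none) :
    hAux (n + 1) α γ = (α 0).toList.map Sum.inl ++ hAux n (tail α) (tail γ) := by
  cases h' : α 0 <;> simp only [hAux, h, h'] <;> rfl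

lemma hAux_of_zeroFrom_zero {n a : ℕ} {α : ℕ → Option W} {γ : ℕ → Option A}
    (hγ : ZeroFrom 0 γ) (hα : ZeroFrom a α) (hn : a ≤ n) :
    hAux n α γ = (zeroFree a α).map Sum.inl := by
  induction n generalizing a α γ with
  | zero =>
    obtain rfl : a = 0 := by omega
    rfl
  | succ n ih =>
    rw [hAux_succ_none (hγ 0 le_rfl), hα.zeroFree_eq, ih hγ.tail hα.tail (by omega),
      List.map_append]

@[simp] lemma leftW_cons_inr (c : A) (x : List (W ⊕ A)) :
    leftW (Sum.inr c :: x) = leftW x := rfl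

@[simp] lemma leftW_cons_inl (w : W) (x : List (W ⊕ A)) :
    leftW (Sum.inl w :: x) = w :: leftW x := rfl

lemma leftW_hAux {n a b : ℕ} {α : ℕ → Option W} {γ : ℕ → Option A}
    (hα : ZeroFrom a α) (hγ : ZeroFrom b γ) (hn : a + b ≤ n) :
    leftW (hAux n α γ) = zeroFree a α := by
  induction n generalizing a b α γ with
  | zero =>
    obtain rfl : a = 0 := by omega
    rfl
  | succ n ih =>
    cases h : γ 0 with
    | some c =>
      have hb := hγ.pos h
      rw [hAux_succ_some h, leftW_cons_inr, ih hα hγ.tail (by omega)]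
    | none =>
      have key := ih hα.tail hγ.tail (by omega)
      rw [hAux_succ_none h, hα.zeroFree_eq, ← key]
      cases h' : α 0 <;> simp

lemma exists_hAux_eq (x : List (W ⊕ A)) {a : ℕ} {α : ℕ → Option W} (hα : ZeroFrom a α)
    (hx : leftW x = zeroFree a α) :
    ∃ γ : ℕ → Option A, (∃ b, ZeroFrom b γ) ∧
      ∀ b, ZeroFrom b γ → ∀ n, a + b ≤ n → hAux n α γ = x := by
  induction x generalizing a α with
  | nil =>
    refine ⟨fun _ => none, ⟨0, fun _ _ => rfl⟩, fun b _ n hn => ?_⟩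
    rw [hAux_of_zeroFrom_zero (fun _ _ => rfl) hα (by omega), ← hx]
    rfl
  | cons s x ih =>
    cases s with
    | inr c =>
      obtain ⟨γ, ⟨b₀, hb₀⟩, h⟩ := ih hα hx
      refine ⟨cons (some c) γ, ⟨_, hb₀.cons _⟩, fun b hb n hn => ?_⟩
      have hpos := hb.pos (x := c) rfl
      obtain ⟨n, rfl⟩ : ∃ k, n = k + 1 := ⟨n - 1, by omega⟩
      rw [hAux_succ_some (c := c) rfl, tail_cons, h (b - 1) hb.tail n (by omega)]
    | inl w =>
      replace hx : w :: leftW x = zeroFree a α := hx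
      induction a generalizing α with
      | zero => simp [zeroFree] at hx
      | succ a iha =>
        rw [zeroFree_succ] at hx
        have hstep : ∀ γ : ℕ → Option A, (∃ b, ZeroFrom b γ) →
            (∀ b, ZeroFrom b γ → ∀ n, a + b ≤ n →
              (α 0).toList.map Sum.inl ++ hAux n (tail α) γ = Sum.inl w :: x) →
            ∃ γ : ℕ → Option A, (∃ b, ZeroFrom b γ) ∧
              ∀ b, ZeroFrom b γ → ∀ n, a + 1 + b ≤ n → hAux n α γ = Sum.inl w :: x := by
          rintro γ ⟨b₀, hb₀⟩ h
          refine ⟨cons none γ, ⟨_, hb₀.cons _⟩, fun b hb n hn => ?_⟩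
          obtain ⟨n, rfl⟩ : ∃ k, n = k + 1 := ⟨n - 1, by omega⟩
          rw [hAux_succ_none rfl, tail_cons]
          exact h (b - 1) hb.tail n (by omega)
        cases h0 : α 0 with
        | none =>
          obtain ⟨γ, hb₀, h⟩ := iha hα.tail (by simpa [h0] using hx)
          exact hstep γ hb₀ (by simpa [h0] using h)
        | some w' =>
          simp only [h0, Option.toList_some, List.singleton_append, List.cons.injEq] at hx
          obtain ⟨γ, hb₀, h⟩ := ih hα.tail hx.2
          exact hstep γ hb₀ (by simpa [h0, hx.1] using h)

/-- Appending a letter to `α` beyond the stop of `γ` appends that letter to `h(α, γ)`. -/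
lemma hAux_append {n n' m a b c : ℕ} {α β : ℕ → Option W} {γ : ℕ → Option A} {v : W}
    (hα : ZeroFrom a α) (hβ : ZeroFrom c β) (hγ : ZeroFrom b γ) (hbm : b ≤ m)
    (hαβ : ∀ i, i < m → α i = β i) (hv : zeroFree c β = zeroFree a α ++ [v])
    (hn : a + b ≤ n) (hn' : c + b ≤ n') :
    hAux n' β γ = hAux n α γ ++ [Sum.inl v] := by
  induction b generalizing n n' m a c α β γ with
  | zero =>
    rw [hAux_of_zeroFrom_zero hγ hβ (by omega), hAux_of_zeroFrom_zero hγ hα (by omega), hv,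
      List.map_append]
    rfl
  | succ b ih =>
    obtain ⟨n, rfl⟩ : ∃ k, n = k + 1 := ⟨n - 1, by omega⟩
    obtain ⟨n', rfl⟩ : ∃ k, n' = k + 1 := ⟨n' - 1, by omega⟩
    cases h : γ 0 with
    | some x =>
      rw [hAux_succ_some h, hAux_succ_some h,
        ih (n := n) (m := m) hα hβ hγ.tail (by omega) hαβ hv (by omega) (by omega), List.cons_append]
    | none =>
      rw [hα.zeroFree_eq, hβ.zeroFree_eq, hαβ 0 (by omega), List.append_assoc,
        List.append_cancel_left_eq] at hv
      rw [hAux_succ_none h, hAux_succ_none h, hαβ 0 (by omega), List.append_assoc,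
        ih (n := n) (m := m - 1) hα.tail hβ.tail hγ.tail (by omega)
          (fun i hi => hαβ (i + 1) (by omega)) hv (by omega) (by omega)]

end Sequences

lemma simCls_append_inl {W1 W2 : Type} (R1 : W1 → W1 → Prop) (x0 : W1) (R2 : W2 → W2 → Prop)
    (y0 : W2) {x : List (W1 ⊕ W2)} (hx : x ∈ Ent R1 x0 R2 y0) (v : W1) :
    simCls R1 x0 R2 y0 (x ++ [Sum.inl v]) = simCls R1 x0 R2 y0 x := by
  ext y
  refine and_congr_right fun _ => ⟨?_, ?_⟩
  · rintro ⟨t, ht, c, d, hc, hd⟩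
    rcases List.eq_nil_or_concat' c with rfl | ⟨c, w, rfl⟩
    · refine ⟨x, hx, [], v :: d, by simp, ?_⟩
      simp only [List.map_nil, List.append_nil] at hc
      rw [hd, ← hc]
      simp
    · rw [List.map_append, ← List.append_assoc] at hc
      exact ⟨t, ht, c, d, (List.append_inj' hc rfl).1, hd⟩
  · rintro ⟨t, ht, c, d, rfl, hd⟩
    exact ⟨t, ht, c ++ [v], d, by simp, hd⟩

section Paths

variable {W : Type} {R : W → W → Prop} {w0 : W}

lemma isChain_totR (l : List Rnz) : l.IsChain TotR := by
  induction l with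
  | nil => exact .nil
  | cons a l ih => cases l with
    | nil => exact .singleton a
    | cons b l => exact .cons_cons trivial ih

lemma hfun_mem_Dprime (α : Wom W R w0) (γ : Wom Rnz TotR y0R) :
    hfun α γ ∈ Dprime R w0 TotR y0R (fzero α) := by
  have h : leftW (hfun α γ) = zf α.1 :=
    leftW_hAux (zeroFrom_stOf α.2.1) (zeroFrom_stOf γ.2.1) le_rfl
  refine ⟨⟨?_, isChain_totR _⟩, ?_⟩
  · rw [h]
    exact α.2.2
  · rw [h]
    rfl

lemma Uk_antitone (α : Wom W R w0) : Antitone fun n => Uk n α := fun _ _ hmn _ hβ =>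
  ⟨fun i hi => hβ.1 i (hi.trans_le (max_le_max_right _ hmn)), hβ.2⟩

lemma mem_tauOm {α : Wom W R w0} {U : Set (Wom W R w0)} :
    U ∈ tauOm R w0 α ↔ ∃ n, Uk n α ⊆ U := by
  unfold tauOm
  rw [Filter.mem_iInf_of_directed]
  · simp
  · exact directed_of_isDirected_le fun _ _ hmn => Filter.principal_mono.2 (Uk_antitone α hmn)

lemma Uk_mem_tauOm (n : ℕ) (α : Wom W R w0) : Uk n α ∈ tauOm R w0 α :=
  mem_tauOm.2 ⟨n, subset_rfl⟩

lemma fzero_surjective : Function.Surjective (fzero : Wom W R w0 → Unravel W R w0) := by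
  rintro ⟨l, hl, hR⟩
  obtain ⟨l, rfl⟩ : ∃ t, l = w0 :: t := by
    cases l with
    | nil => simp at hl
    | cons a t => exact ⟨t, by simpa using hl⟩
  have hz : ZeroFrom l.length (fun i => l[i]?) := fun k hk => List.getElem?_eq_none hk
  have hzf : zf (fun i => l[i]?) = l := hz.zf_eq.trans (zeroFree_getElem? l)
  exact ⟨⟨fun i => l[i]?, ⟨_, hz⟩, by rw [hzf]; exact hR⟩,
    Subtype.ext (congrArg (List.cons w0) hzf)⟩

/-- Every `R^♯`-successor of `f₀(α)` is the image of a point of `U_n(α)`. -/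
lemma exists_mem_Uk_fzero_eq (n : ℕ) (α : Wom W R w0) {u : Unravel W R w0}
    (hu : RSharp R w0 (fzero α) u) : ∃ β ∈ Uk n α, fzero β = u := by
  obtain ⟨v, hv, -⟩ := id hu
  set m := max n (stOf α.1)
  have hα := zeroFrom_stOf α.2.1
  let β : ℕ → Option W := Function.update α.1 m (some v)
  have hβα : ∀ i, i ≠ m → β i = α.1 i := fun i hi => Function.update_of_ne hi _ _
  have hβ : ZeroFrom (m + 1) β := fun k hk => by
    rw [hβα k (by omega)]
    exact hα k ((le_max_right n _).trans (by omega))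
  have hzf : w0 :: zf β = u.1 := by
    rw [hβ.zf_eq, zeroFree_succ_last, zeroFree_congr fun i hi => hβα i hi.ne,
      hα.zeroFree_eq_of_le (le_max_right n _), hv]
    simp [β, fzero, zeroFree, zf]
  let b : Wom W R w0 := ⟨β, ⟨_, hβ⟩, by rw [hzf]; exact u.2.2⟩
  have hb : fzero b = u := Subtype.ext hzf
  exact ⟨b, ⟨fun i hi => (hβα i hi.ne).symm, by rw [hb]; exact hu⟩, hb⟩

lemma fzero_isPMorphismN :
    IsPMorphismN (tauOm R w0) (nbhdOf (RSharp R w0)) (fzero : Wom W R w0 → Unravel W R w0) := by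
  refine ⟨fzero_surjective, fun α U hU => ?_, fun α V hV => ?_⟩
  · obtain ⟨n, hn⟩ := mem_tauOm.1 hU
    refine Filter.mem_principal.2 fun u hu => ?_
    obtain ⟨β, hβ, rfl⟩ := exists_mem_Uk_fzero_eq n α hu
    exact ⟨β, hn hβ, rfl⟩
  · exact mem_tauOm.2 ⟨0, fun β hβ => Filter.mem_principal.1 hV hβ.2⟩

end Paths

end Entanglement

/-- the pair `(f₀, ξ)`, with `ξ_α(γ) = [h(α, γ)]`, is a p-morphism
from the predicate n-frame `(N_ω(F), ℝ_ω)` with constant domain to the predicate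
Kripke frame `pF^♯ = (F^♯, D^♯)`. -/
theorem fzero_xi_pred_pmorphism {W : Type} (R : W → W → Prop) (w0 : W)
    (hroot : IsRootedAt R w0) :
    IsPredNPMorph (tauOm R w0) (RSharp R w0) (Dsharp R w0 TotR y0R)
      (fzero : Wom W R w0 → Unravel W R w0)
      (fun (α : Wom W R w0) (γ : Wom Rnz TotR y0R) =>
        simCls R w0 TotR y0R (hfun α γ)) := by
  refine ⟨Entanglement.fzero_isPMorphismN,
    fun α γ => ⟨hfun α γ, Entanglement.hfun_mem_Dprime α γ, rfl⟩, ?_, fun γ α => ?_⟩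
  · rintro α e ⟨x, ⟨-, hx⟩, rfl⟩
    obtain ⟨γ, hb, hγ⟩ := Entanglement.exists_hAux_eq x (Entanglement.zeroFrom_stOf α.2.1)
      (List.cons.inj hx).2
    exact ⟨⟨γ, hb, Entanglement.isChain_totR _⟩,
      congrArg _ (hγ _ (Entanglement.zeroFrom_stOf hb) _ le_rfl)⟩
  · refine ⟨_, Entanglement.Uk_mem_tauOm (stOf γ.1) α, ?_⟩
    rintro β ⟨hαβ, v, hv, -⟩
    have h : hfun β γ = hfun α γ ++ [Sum.inl v] :=
      Entanglement.hAux_append (Entanglement.zeroFrom_stOf α.2.1)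
        (Entanglement.zeroFrom_stOf β.2.1) (Entanglement.zeroFrom_stOf γ.2.1)
        (le_max_left _ _) hαβ (List.cons.inj hv).2 le_rfl le_rfl
    beta_reduce
    rw [h, Entanglement.simCls_append_inl _ _ _ _ (Entanglement.hfun_mem_Dprime α γ).1]
end
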